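/- For all b ≥ 2 and ε > 0, if D ≥ x^{1/3+ε} then S_b(x,D) ≪_b x^{1/2−ε}, i.e. there is a constant C depending only on b such that S_b(x,D) ≤ C x^{1/2−ε} for all x ≥ 1 and D ≥ x^{1/3+ε}. -/

import Mathlib

/-- A positive integer `n` is a base-`b` palindrome if `b ∤ n` and its base-`b`
digit string reads the same forwards and backwards. -/
def IsBPalindrome (b n : ℕ) : Prop := ¬ b ∣ n ∧ (Nat.digits b n).Palindrome

/-- `𝒫*_b(x)`: base-`b` palindromes `n ≤ x` with `gcd(n, b³ - b) = 1`. -/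
def PstarSet (b : ℕ) (x : ℝ) : Set ℕ :=
  {n : ℕ | 0 < n ∧ (n : ℝ) ≤ x ∧ IsBPalindrome b n ∧ Nat.gcd n (b ^ 3 - b) = 1}

/-- `S_b(x, D)`: the number of `n ∈ 𝒫*_b(x)` divisible by `d²` for some
integer `d` with `D ≤ d ≤ 2D`. -/
noncomputable def Scount (b : ℕ) (x D : ℝ) : ℕ :=
  {n : ℕ | n ∈ PstarSet b x ∧ ∃ d : ℕ, D ≤ (d : ℝ) ∧ (d : ℝ) ≤ 2 * D ∧ d ^ 2 ∣ n}.ncard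

theorem prime_pow_dvd_two_mul_sub_or_add {p j : ℕ} (hp : p.Prime) {a c : ℤ}
    (ha : ¬ (p : ℤ) ∣ a) (h : ((p ^ j : ℕ) : ℤ) ∣ a ^ 2 - c ^ 2) :
    ((p ^ j : ℕ) : ℤ) ∣ 2 * (a - c) ∨ ((p ^ j : ℕ) : ℤ) ∣ 2 * (a + c) := by
  have hpz : Prime (p : ℤ) := Nat.prime_iff_prime_int.mp hp
  push_cast at h ⊢
  have hcop : ∀ z : ℤ, ¬ (p : ℤ) ∣ z → IsCoprime ((p : ℤ) ^ j) z := fun z hz =>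
    ((Prime.coprime_iff_not_dvd hpz).2 hz).pow_left
  by_cases hp2 : p = 2
  · subst hp2
    by_cases hc : (2 : ℤ) ∣ a - c
    · obtain ⟨u, hu⟩ := hc
      have hv : a + c = 2 * (a - u) := by linarith
      have hfac : a ^ 2 - c ^ 2 = u * (2 * (a + c)) := by
        have : a ^ 2 - c ^ 2 = (a - c) * (a + c) := by ring
        rw [this, hu]; ring
      have hfac' : a ^ 2 - c ^ 2 = (a - u) * (2 * (a - c)) := by
        have : a ^ 2 - c ^ 2 = (a - c) * (a + c) := by ring
        rw [this, hv]; ring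
      by_cases hu2 : ((2 : ℕ) : ℤ) ∣ u
      · left
        refine (hcop (a - u) fun h2 => ha ?_).dvd_of_dvd_mul_left (hfac' ▸ h)
        simpa using dvd_add h2 hu2
      · right
        exact (hcop u hu2).dvd_of_dvd_mul_left (hfac ▸ h)
    · right
      have hfac : a ^ 2 - c ^ 2 = (a - c) * (a + c) := by ring
      exact ((hcop (a - c) (by exact_mod_cast hc)).dvd_of_dvd_mul_left (hfac ▸ h)).mul_left 2
  · have hfac : a ^ 2 - c ^ 2 = (a - c) * (a + c) := by ring
    by_cases h1 : (p : ℤ) ∣ a - c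
    · left
      have h2 : ¬ (p : ℤ) ∣ a + c := by
        intro h2
        have h3 : (p : ℤ) ∣ 2 * a := by
          have := dvd_add h1 h2
          rwa [show a - c + (a + c) = 2 * a by ring] at this
        rcases hpz.dvd_or_dvd h3 with h4 | h4
        · exact hp2 ((Nat.prime_dvd_prime_iff_eq hp Nat.prime_two).1 (by exact_mod_cast h4))
        · exact ha h4
      exact ((hcop _ h2).dvd_of_dvd_mul_right (hfac ▸ h)).mul_left 2
    · right
      exact ((hcop _ h1).dvd_of_dvd_mul_left (hfac ▸ h)).mul_left 2

/-- A set of integers coprime to `b`, with congruent squares modulo `b ^ k` and diameter less than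
`L * b ^ k`, has cardinality bounded in terms of `b` and `L`. -/
theorem card_le_of_sq_congr {b k L : ℕ} (hb : 2 ≤ b) (F : Finset ℕ)
    (hcop : ∀ d ∈ F, Nat.Coprime d b)
    (hsq : ∀ d ∈ F, ∀ e ∈ F, ((b ^ k : ℕ) : ℤ) ∣ (d : ℤ) ^ 2 - (e : ℤ) ^ 2)
    (hdiam : ∀ d ∈ F, ∀ e ∈ F, d < e + L * b ^ k) :
    F.card ≤ 2 ^ b.primeFactors.card * (2 * L) := by
  classical
  rcases F.eq_empty_or_nonempty with rfl | hne
  · simp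
  have hbk : 0 < b ^ k := by positivity
  set d₀ := F.min' hne with hd₀
  have hd₀F : d₀ ∈ F := F.min'_mem hne
  have hmin : ∀ d ∈ F, d₀ ≤ d := fun d hd => F.min'_le d hd
  let q : ℕ → ℕ := fun p => p ^ (b ^ k).factorization p
  let S : ℕ → Finset ℕ := fun d =>
    b.primeFactors.filter fun p => (q p : ℤ) ∣ 2 * ((d : ℤ) - d₀)
  have key : F.card ≤ (b.primeFactors.powerset ×ˢ Finset.range (2 * L)).card := by
    refine Finset.card_le_card_of_injOn (fun d => (S d, 2 * (d - d₀) / b ^ k)) ?_ ?_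
    · intro d hd
      have hd' : d ∈ F := hd
      have h1 := hdiam d hd' d₀ hd₀F
      have h2 := hmin d hd'
      simp only [Finset.coe_product, Set.mem_prod, Finset.mem_coe, Finset.mem_powerset,
        Finset.mem_range]
      refine ⟨Finset.filter_subset _ _, (Nat.div_lt_iff_lt_mul hbk).2 ?_⟩
      rw [mul_assoc]
      omega
    · intro d hd e he hde
      have hdF : d ∈ F := hd
      have heF : e ∈ F := he
      have hd1 := hmin d hdF
      have he1 := hmin e heF
      simp only [Prod.mk.injEq] at hde
      obtain ⟨hS, hq⟩ := hde
      have hdvd : ((b ^ k : ℕ) : ℤ) ∣ 2 * ((d : ℤ) - e) := by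
        rw [Int.natCast_dvd, Nat.dvd_iff_prime_pow_dvd_dvd]
        intro p j hp hj
        rw [← Int.natCast_dvd]
        rcases Nat.eq_zero_or_pos j with rfl | hj0
        · simp
        have hpb : p ∣ b := hp.dvd_of_dvd_pow ((dvd_pow_self p hj0.ne').trans hj)
        have hpm : p ∈ b.primeFactors := Nat.mem_primeFactors.2 ⟨hp, hpb, by omega⟩
        have hjq : p ^ j ∣ q p :=
          pow_dvd_pow p ((hp.pow_dvd_iff_le_factorization hbk.ne').1 hj)
        refine (Int.natCast_dvd_natCast.2 hjq).trans ?_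
        have hqb : (q p : ℤ) ∣ ((b ^ k : ℕ) : ℤ) :=
          Int.natCast_dvd_natCast.2 (Nat.ordProj_dvd _ _)
        have hnd : ∀ f ∈ F, ¬ (p : ℤ) ∣ (f : ℤ) := fun f hf h =>
          hp.one_lt.ne' (Nat.eq_one_of_dvd_coprimes (hcop f hf) (Int.natCast_dvd_natCast.1 h) hpb)
        by_cases hpS : p ∈ S d
        · have h1 := (Finset.mem_filter.1 hpS).2
          have h2 := (Finset.mem_filter.1 (hS ▸ hpS)).2
          have := dvd_sub h1 h2
          rwa [show 2 * ((d : ℤ) - d₀) - 2 * ((e : ℤ) - d₀) = 2 * ((d : ℤ) - e) by ring] at this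
        · have hplus : ∀ f ∈ F, p ∉ S f → (q p : ℤ) ∣ 2 * ((f : ℤ) + d₀) := fun f hf hpf =>
            (prime_pow_dvd_two_mul_sub_or_add hp (hnd f hf)
              (hqb.trans (hsq f hf d₀ hd₀F))).resolve_left
              fun h => hpf (Finset.mem_filter.2 ⟨hpm, h⟩)
          have := dvd_sub (hplus d hdF hpS) (hplus e heF (hS ▸ hpS))
          rwa [show 2 * ((d : ℤ) + d₀) - 2 * ((e : ℤ) + d₀) = 2 * ((d : ℤ) - e) by ring] at this
      have hmod : 2 * (e - d₀) ≡ 2 * (d - d₀) [MOD b ^ k] := by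
        rw [Nat.modEq_iff_dvd]
        push_cast [hd1, he1] at hdvd ⊢
        rwa [show 2 * ((d : ℤ) - d₀) - 2 * ((e : ℤ) - d₀) = 2 * ((d : ℤ) - e) by ring]
      have h3 := Nat.div_add_mod (2 * (d - d₀)) (b ^ k)
      have h4 := Nat.div_add_mod (2 * (e - d₀)) (b ^ k)
      rw [hq, ← hmod, h4] at h3
      omega
  simpa [Finset.card_product, Finset.card_powerset] using key

theorem palindrome_mod_pow_eq {b k n₁ n₂ : ℕ} (hb : 2 ≤ b)
    (h₁ : (Nat.digits b n₁).Palindrome) (h₂ : (Nat.digits b n₂).Palindrome)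
    (hlen : (Nat.digits b n₁).length = (Nat.digits b n₂).length)
    (htop : n₁ / b ^ ((Nat.digits b n₁).length - k) = n₂ / b ^ ((Nat.digits b n₁).length - k)) :
    n₁ % b ^ k = n₂ % b ^ k := by
  have hdrop : (Nat.digits b n₁).drop ((Nat.digits b n₁).length - k)
      = (Nat.digits b n₂).drop ((Nat.digits b n₁).length - k) := by
    rw [Nat.self_div_pow_eq_ofDigits_drop _ _ hb, Nat.self_div_pow_eq_ofDigits_drop _ _ hb] at htop
    refine Nat.ofDigits_inj_of_len_eq (by omega) (by simp [hlen]) ?_ ?_ htop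
    · exact fun l hl => Nat.digits_lt_base (by omega) (List.mem_of_mem_drop hl)
    · exact fun l hl => Nat.digits_lt_base (by omega) (List.mem_of_mem_drop hl)
  have htake : (Nat.digits b n₁).take k = (Nat.digits b n₂).take k := by
    rw [← h₁.reverse_eq, ← h₂.reverse_eq, List.take_reverse, List.take_reverse, hdrop, hlen]
  rw [Nat.self_mod_pow_eq_ofDigits_take _ _ hb, Nat.self_mod_pow_eq_ofDigits_take _ _ hb, htake]

/-- For fixed `m`, bound the number of `d ∈ [D, 2D]` with `d² m` a palindrome coprime to `b`. -/
theorem card_palindrome_sq_mul_le {b k D m : ℕ} (hb : 2 ≤ b) (hm : 0 < m)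
    (hk : b ^ (2 * k) ≤ D) (hk' : D < b ^ (2 * k + 2)) (F : Finset ℕ)
    (hF : ∀ d ∈ F, D ≤ d ∧ d ≤ 2 * D ∧ (Nat.digits b (d ^ 2 * m)).Palindrome ∧
      Nat.Coprime (d ^ 2 * m) b) :
    F.card ≤ 2 ^ b.primeFactors.card * (2 * (2 * b ^ 3)) * (3 * b ^ k) := by
  classical
  have hbk : 0 < b ^ k := by positivity
  have hD : 0 < D := lt_of_lt_of_le (by positivity) hk
  have hlow : ∀ d ∈ F, D ^ 2 * m ≤ d ^ 2 * m := fun d hd => by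
    have := (hF d hd).1
    gcongr
  have hup : ∀ d ∈ F, d ^ 2 * m ≤ 4 * D ^ 2 * m := fun d hd => by
    have := Nat.pow_le_pow_left (hF d hd).2.1 2
    rw [mul_pow] at this
    gcongr
    exact this
  have hpos : ∀ d ∈ F, d ^ 2 * m ≠ 0 := fun d hd =>
    (lt_of_lt_of_le (by positivity) (hlow d hd)).ne'
  have hlen : ∀ d ∈ F, (Nat.digits b (d ^ 2 * m)).length = Nat.log b (d ^ 2 * m) + 1 :=
    fun d hd => Nat.length_digits b _ (by omega) (hpos d hd)
  have hlog : ∀ d ∈ F, k ≤ Nat.log b (d ^ 2 * m) := fun d hd => by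
    refine Nat.le_log_of_pow_le (by omega) ?_
    calc b ^ k ≤ b ^ (2 * k) := Nat.pow_le_pow_right (by omega) (by omega)
      _ ≤ D := hk
      _ ≤ D ^ 2 * m := by nlinarith [Nat.mul_le_mul hD hD]
      _ ≤ d ^ 2 * m := hlow d hd
  let E := Nat.log b (D ^ 2 * m)
  let key : ℕ → ℕ × ℕ := fun d => (Nat.log b (d ^ 2 * m),
    d ^ 2 * m / b ^ (Nat.log b (d ^ 2 * m) + 1 - k))
  have hmaps : ∀ d ∈ F, key d ∈ Finset.Icc E (E + 2) ×ˢ Finset.range (b ^ k) := by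
    intro d hd
    rw [Finset.mem_product, Finset.mem_Icc, Finset.mem_range]
    refine ⟨⟨Nat.log_mono_right (hlow d hd), ?_⟩, ?_⟩
    · change Nat.log b (d ^ 2 * m) ≤ E + 2
      refine Nat.le_of_lt_succ (Nat.log_lt_of_lt_pow (hpos d hd) ?_)
      have h1 : D ^ 2 * m < b ^ (E + 1) := Nat.lt_pow_succ_log_self (by omega) _
      have h2 : 4 ≤ b ^ 2 := by nlinarith
      calc d ^ 2 * m ≤ 4 * (D ^ 2 * m) := by rw [← mul_assoc]; exact hup d hd
        _ < b ^ 2 * b ^ (E + 1) := by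
          exact Nat.mul_lt_mul_of_le_of_lt h2 h1 (by positivity)
        _ = b ^ (E + 2).succ := by rw [← pow_add]; congr 1; omega
    · change d ^ 2 * m / b ^ (Nat.log b (d ^ 2 * m) + 1 - k) < b ^ k
      rw [Nat.div_lt_iff_lt_mul (by positivity), ← pow_add]
      have := hlog d hd
      rw [show k + (Nat.log b (d ^ 2 * m) + 1 - k) = Nat.log b (d ^ 2 * m) + 1 by omega]
      exact Nat.lt_pow_succ_log_self (by omega) _
  have hfib : ∀ y ∈ Finset.Icc E (E + 2) ×ˢ Finset.range (b ^ k),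
      (F.filter fun d => key d = y).card ≤ 2 ^ b.primeFactors.card * (2 * (2 * b ^ 3)) := by
    intro y _
    refine card_le_of_sq_congr (k := k) hb _ ?_ ?_ ?_
    · intro d hd
      have := (hF d (Finset.mem_filter.1 hd).1).2.2.2
      exact Nat.Coprime.coprime_dvd_left ((dvd_pow_self d two_ne_zero).mul_right m) this
    · intro d hd e he
      obtain ⟨hdF, hdy⟩ := Finset.mem_filter.1 hd
      obtain ⟨heF, hey⟩ := Finset.mem_filter.1 he
      have hde := hdy.trans hey.symm
      simp only [key, Prod.mk.injEq] at hde
      obtain ⟨hl, ht⟩ := hde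
      have hmod : d ^ 2 * m % b ^ k = e ^ 2 * m % b ^ k := by
        refine palindrome_mod_pow_eq hb (hF d hdF).2.2.1 (hF e heF).2.2.1 ?_ ?_
        · rw [hlen d hdF, hlen e heF, hl]
        · rw [hlen d hdF, ht, hl]
      have hdvd := Nat.modEq_iff_dvd.1 (show e ^ 2 * m ≡ d ^ 2 * m [MOD b ^ k] from hmod.symm)
      push_cast at hdvd ⊢
      rw [← sub_mul] at hdvd
      refine IsCoprime.dvd_of_dvd_mul_right (IsCoprime.pow_left ?_) hdvd
      exact Nat.isCoprime_iff_coprime.2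
        (Nat.Coprime.coprime_dvd_left (dvd_mul_left m _) (hF d hdF).2.2.2).symm
    · intro d hd e he
      obtain ⟨hdF, hdy⟩ := Finset.mem_filter.1 hd
      obtain ⟨heF, hey⟩ := Finset.mem_filter.1 he
      have hde := hdy.trans hey.symm
      simp only [key, Prod.mk.injEq] at hde
      obtain ⟨hl, ht⟩ := hde
      rcases le_or_gt d e with hle | hlt
      · have : 0 < 2 * b ^ 3 * b ^ k := by positivity
        omega
      obtain ⟨t, rfl⟩ := Nat.exists_eq_add_of_lt hlt
      set s := t + 1 with hs
      rw [show e + t + 1 = e + s by omega] at *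
      set N := Nat.log b (e ^ 2 * m) with hN
      have hkN : k ≤ N := hlog e heF
      rw [hl] at ht
      set B := b ^ (N + 1 - k) with hB
      have hBpos : 0 < B := by positivity
      have hBk : B * b ^ k = b ^ N * b := by
        rw [hB, ← pow_add, ← pow_succ]; congr 1; omega
      have hNle : b ^ N ≤ 4 * D ^ 2 * m := (Nat.pow_log_le_self b (hpos e heF)).trans (hup e heF)
      have hclose : (e + s) ^ 2 * m < e ^ 2 * m + B := by
        have h1 := Nat.div_add_mod ((e + s) ^ 2 * m) B
        have h2 := Nat.div_add_mod (e ^ 2 * m) B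
        have h3 := Nat.mod_lt ((e + s) ^ 2 * m) hBpos
        rw [ht] at h1
        omega
      have heD := (hF e heF).1
      have h1 : s * (2 * D) * m < B := by
        have : s * (2 * D) * m ≤ (s * (2 * e) + s ^ 2) * m := by
          gcongr
          nlinarith [Nat.mul_le_mul_left s heD]
        nlinarith
      have h2 : s * b ^ k * (2 * D * m) < 2 * b * D * (2 * D * m) := by
        calc s * b ^ k * (2 * D * m) = s * (2 * D) * m * b ^ k := by ring
          _ < B * b ^ k := Nat.mul_lt_mul_of_pos_right h1 hbk
          _ = b ^ N * b := hBk
          _ ≤ 4 * D ^ 2 * m * b := Nat.mul_le_mul_right b hNle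
          _ = _ := by ring
      have h3 : s * b ^ k < 2 * b * D := Nat.lt_of_mul_lt_mul_right h2
      have h4 : s * b ^ k < 2 * b ^ 3 * b ^ k * b ^ k := by
        calc s * b ^ k < 2 * b * D := h3
          _ ≤ 2 * b * b ^ (2 * k + 2) := Nat.mul_le_mul_left _ hk'.le
          _ = _ := by ring
      have := Nat.lt_of_mul_lt_mul_right h4
      omega
  have := Finset.card_le_mul_card_image_of_maps_to hmaps _ hfib
  rw [Finset.card_product, Nat.card_Icc, Finset.card_range] at this
  rwa [show E + 2 + 1 - E = 3 by omega] at this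

theorem Scount_le_mul {b k : ℕ} {x D : ℝ} (hb : 2 ≤ b)
    (hk : b ^ (2 * k) ≤ ⌈D⌉₊) (hk' : ⌈D⌉₊ < b ^ (2 * k + 2)) :
    Scount b x D ≤ ⌊x⌋₊ / ⌈D⌉₊ ^ 2 *
      (2 ^ b.primeFactors.card * (2 * (2 * b ^ 3)) * (3 * b ^ k)) := by
  classical
  set D₀ := ⌈D⌉₊ with hD₀
  have hD₀pos : 0 < D₀ := lt_of_lt_of_le (by positivity) hk
  set M := ⌊x⌋₊ / D₀ ^ 2 with hM
  let F : ℕ → Finset ℕ := fun m => (Finset.Icc D₀ (2 * D₀)).filter fun d =>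
    (Nat.digits b (d ^ 2 * m)).Palindrome ∧ Nat.Coprime (d ^ 2 * m) b
  let G : Finset ℕ := (Finset.Icc 1 M).biUnion fun m => (F m).image fun d => d ^ 2 * m
  have hsub : {n : ℕ | n ∈ PstarSet b x ∧
      ∃ d : ℕ, D ≤ (d : ℝ) ∧ (d : ℝ) ≤ 2 * D ∧ d ^ 2 ∣ n} ⊆ (G : Set ℕ) := by
    rintro n ⟨⟨hn0, hnx, ⟨-, hpal⟩, hgcd⟩, d, hd1, hd2, m, rfl⟩
    have hdD : D₀ ≤ d := Nat.ceil_le.2 hd1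
    have hdD2 : d ≤ 2 * D₀ := by
      have : (d : ℝ) ≤ 2 * (D₀ : ℝ) := hd2.trans (by linarith [Nat.le_ceil D])
      exact_mod_cast this
    have hm0 : 0 < m := Nat.pos_of_mul_pos_left hn0
    have hmM : m ≤ M := by
      rw [hM, Nat.le_div_iff_mul_le (by positivity)]
      refine le_trans ?_ (Nat.le_floor hnx)
      rw [mul_comm]
      gcongr
    have hbdvd : b ∣ b ^ 3 - b := Nat.dvd_sub (dvd_pow_self b three_ne_zero) dvd_rfl
    refine Finset.mem_coe.2 (Finset.mem_biUnion.2 ⟨m, Finset.mem_Icc.2 ⟨hm0, hmM⟩,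
      Finset.mem_image.2 ⟨d, Finset.mem_filter.2 ⟨Finset.mem_Icc.2 ⟨hdD, hdD2⟩, hpal, ?_⟩, rfl⟩⟩)
    exact Nat.Coprime.coprime_dvd_right hbdvd hgcd
  calc Scount b x D ≤ (G : Set ℕ).ncard := Set.ncard_le_ncard hsub G.finite_toSet
    _ = G.card := Set.ncard_coe_finset G
    _ ≤ (Finset.Icc 1 M).card * (2 ^ b.primeFactors.card * (2 * (2 * b ^ 3)) * (3 * b ^ k)) := by
      refine Finset.card_biUnion_le_card_mul _ _ _ fun m hm => Finset.card_image_le.trans ?_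
      refine card_palindrome_sq_mul_le hb (Finset.mem_Icc.1 hm).1 hk hk' _ fun d hd => ?_
      obtain ⟨h1, h2, h3⟩ := Finset.mem_filter.1 hd
      exact ⟨(Finset.mem_Icc.1 h1).1, (Finset.mem_Icc.1 h1).2, h2, h3⟩
    _ = _ := by rw [Nat.card_Icc, Nat.add_sub_cancel]

/-- For all `b ≥ 2` and `ε > 0`, if `D ≥ x^{1/3+ε}` then `S_b(x,D) ≪_b x^{1/2-ε}`:
there is a constant `C` depending only on `b` such that `S_b(x,D) ≤ C x^{1/2-ε}`
for all `x ≥ 1` and `D ≥ x^{1/3+ε}`. -/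
theorem Scount_le_of_D_ge_third (b : ℕ) (hb : 2 ≤ b) :
    ∃ C : ℝ, ∀ ε : ℝ, 0 < ε → ∀ x D : ℝ, 1 ≤ x → x ^ ((1 : ℝ) / 3 + ε) ≤ D →
      (Scount b x D : ℝ) ≤ C * x ^ ((1 : ℝ) / 2 - ε) := by
  refine ⟨2 ^ b.primeFactors.card * (2 * (2 * (b : ℝ) ^ 3)) * 3, fun ε hε x D hx hD => ?_⟩
  have hx0 : 0 < x := by linarith
  have hDpos : 0 < D := lt_of_lt_of_le (by positivity) hD
  have hD₀pos : 0 < ⌈D⌉₊ := Nat.ceil_pos.2 hDpos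
  set k := Nat.log (b ^ 2) ⌈D⌉₊ with hkdef
  have hk : b ^ (2 * k) ≤ ⌈D⌉₊ := by
    rw [pow_mul]
    exact Nat.pow_log_le_self _ hD₀pos.ne'
  have hk' : ⌈D⌉₊ < b ^ (2 * k + 2) := by
    rw [show 2 * k + 2 = 2 * (k + 1) by ring, pow_mul]
    exact Nat.lt_pow_succ_log_self (by nlinarith) _
  have hcount : (Scount b x D : ℝ) ≤ ((⌊x⌋₊ / ⌈D⌉₊ ^ 2 : ℕ) : ℝ) *
      (2 ^ b.primeFactors.card * (2 * (2 * (b : ℝ) ^ 3)) * (3 * (b : ℝ) ^ k)) := by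
    exact_mod_cast Scount_le_mul (x := x) hb hk hk'
  set Y : ℝ := (⌈D⌉₊ : ℝ) with hY
  have hYpos : 0 < Y := by exact Nat.cast_pos.2 hD₀pos
  have hxY : x ^ ((1 : ℝ) / 3 + ε) ≤ Y := hD.trans (Nat.le_ceil D)
  have hM : ((⌊x⌋₊ / ⌈D⌉₊ ^ 2 : ℕ) : ℝ) ≤ x / Y ^ 2 := by
    refine Nat.cast_div_le.trans ?_
    push_cast
    gcongr
    exact Nat.floor_le hx0.le
  have hbk : (b : ℝ) ^ k ≤ Y ^ ((1 : ℝ) / 2) := by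
    rw [← Real.sqrt_eq_rpow]
    refine Real.le_sqrt_of_sq_le ?_
    rw [← pow_mul, mul_comm k 2]
    simpa [hY] using (Nat.cast_le (α := ℝ)).2 hk
  have hmain : ((⌊x⌋₊ / ⌈D⌉₊ ^ 2 : ℕ) : ℝ) * (b : ℝ) ^ k ≤ x ^ ((1 : ℝ) / 2 - ε) := by
    calc ((⌊x⌋₊ / ⌈D⌉₊ ^ 2 : ℕ) : ℝ) * (b : ℝ) ^ k
        ≤ x / Y ^ 2 * Y ^ ((1 : ℝ) / 2) := by gcongr
      _ = x * Y ^ (-(3 : ℝ) / 2) := by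
        rw [div_mul_eq_mul_div, mul_div_assoc, ← Real.rpow_natCast Y 2, ← Real.rpow_sub hYpos]
        norm_num
      _ ≤ x * (x ^ ((1 : ℝ) / 3 + ε)) ^ (-(3 : ℝ) / 2) := by
        gcongr x * ?_
        exact Real.rpow_le_rpow_of_nonpos (by positivity) hxY (by norm_num)
      _ = x ^ ((1 : ℝ) / 2 - 3 / 2 * ε) := by
        rw [← Real.rpow_mul hx0.le]
        nth_rewrite 1 [← Real.rpow_one x]
        rw [← Real.rpow_add hx0]
        congr 1; ring
      _ ≤ x ^ ((1 : ℝ) / 2 - ε) := Real.rpow_le_rpow_of_exponent_le hx (by linarith)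
  calc (Scount b x D : ℝ) ≤ _ := hcount
    _ = 2 ^ b.primeFactors.card * (2 * (2 * (b : ℝ) ^ 3)) * 3 *
        (((⌊x⌋₊ / ⌈D⌉₊ ^ 2 : ℕ) : ℝ) * (b : ℝ) ^ k) := by ring
    _ ≤ _ := by gcongr
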